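/- For any sequence of internal quadrature methods I_n on [a,b] and any k ≥ 1, the adversarial sequence f_n of Theorem 2 shows: there is no constant C and no exponent α > k+1 with |I_n(g) - ∫_a^b g| ≤ C n^{-α} for all g ∈ C^{k-1}[a,b] with ‖g^{(k-1)}‖_∞ ≤ (b-a)k!/4; i.e., the worst-case error over this class is at least (b-a)^{k+1} 4^{-k} (n+1)^{-(k+1)}. -/

import Mathlib

open intervalIntegral in
theorem exists_iteratedDeriv_eq_of_moments_eq_zero (m : ℕ) (ψ : ℝ → ℝ) (hψ : Continuous ψ)
    (hsupp : ∀ x, 1 ≤ |x| → ψ x = 0)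
    (hmom : ∀ j < m, ∫ x in (-1 : ℝ)..1, x ^ j * ψ x = 0) :
    ∃ g : ℝ → ℝ, ContDiff ℝ m g ∧ iteratedDeriv m g = ψ ∧ (∀ x, 1 ≤ |x| → g x = 0) ∧
      ∫ x in (-1 : ℝ)..1, g x = (-1) ^ m / m.factorial * ∫ x in (-1 : ℝ)..1, x ^ m * ψ x := by
  induction m generalizing ψ with
  | zero => exact ⟨ψ, by simpa [contDiff_zero] using hψ, by simp, hsupp, by simp⟩
  | succ m ih =>
    set φ : ℝ → ℝ := fun x => ∫ t in (-1 : ℝ)..x, ψ t with hφ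
    have hderiv (x : ℝ) : HasDerivAt φ (ψ x) x := hψ.integral_hasStrictDerivAt _ _ |>.hasDerivAt
    have hφc : Continuous φ := continuous_iff_continuousAt.2 fun x => (hderiv x).continuousAt
    have h0 : ∫ x in (-1 : ℝ)..1, ψ x = 0 := by simpa using hmom 0 (by omega)
    have hφsupp (x : ℝ) (hx : 1 ≤ |x|) : φ x = 0 := by
      rcases le_abs.1 hx with h | h
      · have h1 : ∫ t in (1 : ℝ)..x, ψ t = ∫ t in (1 : ℝ)..x, (0 : ℝ) := by
          refine integral_congr fun t ht => hsupp t ?_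
          rw [Set.uIcc_of_le h] at ht
          exact ht.1.trans (le_abs_self t)
        have h2 := integral_add_adjacent_intervals (μ := MeasureTheory.volume)
          (hψ.intervalIntegrable (-1) 1) (hψ.intervalIntegrable 1 x)
        simp only [hφ]
        rw [← h2, h0, h1]
        simp
      · have h1 : ∫ t in (-1 : ℝ)..x, ψ t = ∫ t in (-1 : ℝ)..x, (0 : ℝ) := by
          refine integral_congr fun t ht => hsupp t ?_
          rw [Set.uIcc_of_ge (by linarith)] at ht
          exact le_trans (by linarith [ht.2]) (neg_le_abs t)
        simpa [hφ] using h1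
    have hparts (j : ℕ) : ∫ x in (-1 : ℝ)..1, x ^ j * φ x =
        -(1 / (j + 1 : ℝ)) * ∫ x in (-1 : ℝ)..1, x ^ (j + 1) * ψ x := by
      have h := integral_mul_deriv_eq_deriv_mul (a := (-1 : ℝ)) (b := 1)
        (u := fun x : ℝ => x ^ (j + 1)) (u' := fun x => (j + 1 : ℝ) * x ^ j) (v := φ) (v' := ψ)
        (fun x _ => by simpa using hasDerivAt_pow (j + 1) x) (fun x _ => hderiv x)
        (Continuous.intervalIntegrable (by fun_prop) _ _) (hψ.intervalIntegrable _ _)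
      rw [hφsupp 1 (by simp), hφsupp (-1) (by simp)] at h
      simp only [mul_assoc, integral_const_mul] at h
      rw [h]
      field_simp
      ring
    obtain ⟨g, hg, hgd, hgs, hgi⟩ := ih φ hφc hφsupp fun j hj => by
      rw [hparts, hmom (j + 1) (by omega), mul_zero]
    have hdφ : deriv φ = ψ := funext fun x => (hderiv x).deriv
    refine ⟨g, ?_, ?_, hgs, ?_⟩
    · rw [contDiff_nat_succ_iff_contDiff_one_iteratedDeriv, hgd, contDiff_one_iff_deriv, hdφ]
      exact ⟨hg, fun x => (hderiv x).differentiableAt, hψ⟩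
    · rw [iteratedDeriv_succ, hgd, hdφ]
    · rw [hgi, hparts, Nat.factorial_succ]
      push_cast
      field_simp
      ring

open Real intervalIntegral in
theorem integral_sin_mul_sin_mul_cos_pow_succ (q : ℝ) (j : ℕ) :
    ∫ θ in (0 : ℝ)..π, sin (q * θ) * sin θ * cos θ ^ (j + 1) =
      ((∫ θ in (0 : ℝ)..π, sin ((q + 1) * θ) * sin θ * cos θ ^ j) +
        ∫ θ in (0 : ℝ)..π, sin ((q - 1) * θ) * sin θ * cos θ ^ j) / 2 := by
  rw [← integral_add (Continuous.intervalIntegrable (by fun_prop) _ _)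
    (Continuous.intervalIntegrable (by fun_prop) _ _), ← integral_div]
  refine integral_congr fun θ _ => ?_
  simp only [add_mul, sub_mul, one_mul, sin_add, sin_sub]
  ring

open Real intervalIntegral in
theorem integral_sin_nat_mul_sin (q : ℕ) (hq : 2 ≤ q) :
    ∫ θ in (0 : ℝ)..π, sin (q * θ) * sin θ = 0 := by
  have hq' : (2 : ℝ) ≤ q := by exact_mod_cast hq
  have h1 : (q : ℝ) - 1 ≠ 0 := by linarith
  have h2 : (q : ℝ) + 1 ≠ 0 := by linarith
  have hderiv (θ : ℝ) : HasDerivAt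
      (fun θ => (sin ((q - 1) * θ) / (q - 1) - sin ((q + 1) * θ) / (q + 1)) / 2)
      (sin (q * θ) * sin θ) θ := by
    have hs (c : ℝ) : HasDerivAt (fun θ => sin (c * θ)) (cos (c * θ) * c) θ := by
      simpa using ((hasDerivAt_id θ).const_mul c).sin
    refine ((((hs (q - 1)).div_const (q - 1)).sub
      ((hs (q + 1)).div_const (q + 1))).div_const 2).congr_deriv ?_
    rw [mul_div_cancel_right₀ _ h1, mul_div_cancel_right₀ _ h2]
    simp only [add_mul, sub_mul, one_mul, cos_add, cos_sub]
    ring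
  rw [integral_eq_sub_of_hasDerivAt (fun θ _ => hderiv θ)
    (Continuous.intervalIntegrable (by fun_prop) _ _)]
  have hp : sin ((q + 1) * π) = 0 := by exact_mod_cast sin_nat_mul_pi (q + 1)
  have hm : sin ((q - 1) * π) = 0 := by exact_mod_cast sin_int_mul_pi (q - 1)
  simp [hp, hm]

open Real in
theorem integral_sin_mul_sin_mul_cos_pow_eq_zero (j q : ℕ) (hq : j + 2 ≤ q) :
    ∫ θ in (0 : ℝ)..π, sin (q * θ) * sin θ * cos θ ^ j = 0 := by
  induction j generalizing q with
  | zero => simpa using integral_sin_nat_mul_sin q hq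
  | succ j ih =>
    obtain ⟨q, rfl⟩ : ∃ p, q = p + 1 := ⟨q - 1, by omega⟩
    have h1 := ih (q + 2) (by omega)
    have h2 := ih q (by omega)
    rw [integral_sin_mul_sin_mul_cos_pow_succ]
    push_cast at h1 ⊢
    rw [add_sub_cancel_right, add_assoc, one_add_one_eq_two, h1, h2]
    simp

open Real in
theorem integral_sin_succ_mul_sin_mul_cos_pow (j : ℕ) :
    ∫ θ in (0 : ℝ)..π, sin ((j + 1 : ℕ) * θ) * sin θ * cos θ ^ j = π / 2 ^ (j + 1) := by
  induction j with
  | zero =>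
    have := integral_sin_sq (a := 0) (b := π)
    simp only [sq] at this
    simp [this]
  | succ j ih =>
    have h1 := integral_sin_mul_sin_mul_cos_pow_eq_zero j (j + 3) (by omega)
    rw [integral_sin_mul_sin_mul_cos_pow_succ,
      show ((j + 1 + 1 : ℕ) : ℝ) + 1 = (j + 3 : ℕ) by push_cast; ring,
      show ((j + 1 + 1 : ℕ) : ℝ) - 1 = (j + 1 : ℕ) by push_cast; ring, h1, ih]
    field_simp
    ring

open Real in
theorem integral_pow_mul_sin_mul_arccos (q : ℝ) (j : ℕ) :
    ∫ x in (-1 : ℝ)..1, x ^ j * sin (q * arccos x) =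
      ∫ θ in (0 : ℝ)..π, sin (q * θ) * sin θ * cos θ ^ j := by
  have h := intervalIntegral.integral_comp_mul_deriv (a := 0) (b := π) (f := cos)
    (f' := fun x => -sin x) (g := fun x => x ^ j * sin (q * arccos x))
    (fun x _ => hasDerivAt_cos x) (by fun_prop)
    ((continuous_pow j).mul (continuous_sin.comp (continuous_const.mul continuous_arccos)))
  rw [cos_zero, cos_pi] at h
  rw [intervalIntegral.integral_symm, ← h, ← intervalIntegral.integral_neg]
  refine intervalIntegral.integral_congr fun θ hθ => ?_
  rw [Set.uIcc_of_le pi_pos.le] at hθ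
  simp only [Function.comp, arccos_cos hθ.1 hθ.2]
  ring

open Real in
/-- A `C^m` function supported in `[-1, 1]` whose `m`-th derivative is bounded by `1`,
with large integral: its `m`-th derivative is `sin ((m + 1) * arccos x)`. -/
theorem exists_contDiff_bump_integral (m : ℕ) :
    ∃ g : ℝ → ℝ, ContDiff ℝ m g ∧ (∀ x, |iteratedDeriv m g x| ≤ 1) ∧
      (∀ x, 1 ≤ |x| → g x = 0) ∧
      |∫ x in (-1 : ℝ)..1, g x| = π / (2 ^ (m + 1) * m.factorial) := by
  obtain ⟨g, hg, hgd, hgs, hgi⟩ := exists_iteratedDeriv_eq_of_moments_eq_zero m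
    (fun x => sin ((m + 1 : ℕ) * arccos x))
    (continuous_sin.comp (continuous_const.mul continuous_arccos))
    (fun x hx => by
      rcases le_abs.1 hx with h | h
      · simp [arccos_of_one_le h]
      · simpa only [arccos_of_le_neg_one (le_neg.1 h)] using sin_nat_mul_pi (m + 1))
    (fun j hj => by
      rw [integral_pow_mul_sin_mul_arccos,
        integral_sin_mul_sin_mul_cos_pow_eq_zero j (m + 1) (by omega)])
  refine ⟨g, hg, fun x => hgd ▸ abs_sin_le_one _, hgs, ?_⟩
  rw [hgi, integral_pow_mul_sin_mul_arccos, integral_sin_succ_mul_sin_mul_cos_pow, abs_mul, abs_div,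
    abs_pow, abs_neg, abs_one, one_pow, Nat.abs_cast, abs_of_pos (by positivity)]
  field_simp

/-- Among `n + 1` consecutive intervals of length `2 * r` starting at `a`, one contains none of
`n` given points in its interior. -/
theorem exists_gap (a r : ℝ) (hr : 0 < r) (n : ℕ) (x : Fin n → ℝ) :
    ∃ i : Fin (n + 1), ∀ j, r ≤ |x j - (a + (2 * (i : ℕ) + 1) * r)| := by
  by_contra! h
  choose f hf using h
  have hinj : Function.Injective f := by
    intro i j hij
    have hi := abs_lt.1 (hf i)
    have hj := abs_lt.1 (hf j)
    rw [hij] at hi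
    have h1 : ((i : ℕ) : ℝ) < (j : ℕ) + 1 := by nlinarith
    have h2 : ((j : ℕ) : ℝ) < (i : ℕ) + 1 := by nlinarith
    have h3 : (i : ℕ) < j + 1 := by exact_mod_cast h1
    have h4 : (j : ℕ) < i + 1 := by exact_mod_cast h2
    exact Fin.ext (by omega)
  simpa using Fintype.card_le_of_injective f hinj

theorem worst_case_error_lower_bound (a b : ℝ) (hab : a < b)
    (k : ℕ) (hk : 1 ≤ k) (n : ℕ) (hn : 1 ≤ n)
    (w : Fin n → ℝ) (x : Fin n → ℝ) (hmem : ∀ i, x i ∈ Set.Icc a b) :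
    ∃ g : ℝ → ℝ,
      ContDiffOn ℝ (↑(k - 1) : ℕ∞) g (Set.Icc a b) ∧
      (∀ t ∈ Set.Icc a b,
        |iteratedDerivWithin (k - 1) g (Set.Icc a b) t| ≤ (b - a) * (k.factorial : ℝ) / 4) ∧
      (b - a)^(k+1) / (4^k * (n + 1)^(k+1)) ≤
        |(∑ i, w i * g (x i)) - ∫ t in a..b, g t| := by
  obtain ⟨m, rfl⟩ : ∃ m, k = m + 1 := ⟨k - 1, by omega⟩
  rw [Nat.add_sub_cancel]
  obtain ⟨g, hg, hgd, hgs, hgi⟩ := exists_contDiff_bump_integral m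
  set r : ℝ := (b - a) / (2 * (n + 1)) with hr_def
  have hL : 0 < b - a := sub_pos.2 hab
  have hr : 0 < r := by positivity
  have hLr : b - a = 2 * (n + 1) * r := by rw [hr_def]; field_simp
  obtain ⟨i, hi⟩ := exists_gap a r hr n x
  set c : ℝ := a + (2 * (i : ℕ) + 1) * r with hc
  obtain ⟨A, hA⟩ : ∃ A : ℝ, A = r ^ m * ((b - a) * ((m + 1).factorial : ℝ) / 4) := ⟨_, rfl⟩
  have hA0 : 0 < A := hA ▸ by positivity
  set G : ℝ → ℝ := fun t => A * g (r⁻¹ * (t - c)) with hG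
  have hGc : ContDiff ℝ m G := contDiff_const.mul (hg.comp (by fun_prop))
  have hGzero (t : ℝ) (ht : r ≤ |t - c|) : G t = 0 := by
    simp only [hG]
    rw [hgs _ (by rw [abs_mul, abs_inv, abs_of_pos hr, ← div_eq_inv_mul, one_le_div hr]; exact ht),
      mul_zero]
  have hGd (t : ℝ) : iteratedDeriv m G t = A * ((r⁻¹) ^ m * iteratedDeriv m g (r⁻¹ * (t - c))) := by
    simp only [hG]
    rw [iteratedDeriv_const_mul_field,
      iteratedDeriv_comp_sub_const m (fun z => g (r⁻¹ * z)) c, iteratedDeriv_comp_const_mul hg]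
  have hac : a ≤ c - r := by
    have : 0 ≤ ((i : ℕ) : ℝ) * r := by positivity
    linarith
  have hcb : c + r ≤ b := by
    have h1 : ((i : ℕ) : ℝ) ≤ n := by exact_mod_cast Nat.lt_succ_iff.1 i.2
    have := mul_le_mul_of_nonneg_right h1 hr.le
    linarith
  have hGsupp : Function.support G ⊆ Set.Ioc (c - r) (c + r) := by
    intro t ht
    have := abs_lt.1 (not_le.1 (mt (hGzero t) ht))
    exact ⟨by linarith, by linarith⟩
  have hint : ∫ t in a..b, G t = A * (r * ∫ x in (-1 : ℝ)..1, g x) := by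
    have hsub : Set.Ioc (c - r) (c + r) ⊆ Set.Ioc a b := Set.Ioc_subset_Ioc hac hcb
    rw [intervalIntegral.integral_eq_integral_of_support_subset (hGsupp.trans hsub),
      ← intervalIntegral.integral_eq_integral_of_support_subset hGsupp]
    simp only [hG]
    rw [intervalIntegral.integral_const_mul,
      intervalIntegral.integral_comp_sub_right (fun t => g (r⁻¹ * t)) c,
      intervalIntegral.integral_comp_mul_left g (inv_ne_zero hr.ne'), inv_inv, smul_eq_mul]
    congr 4 <;> field_simp <;> ring
  refine ⟨G, hGc.contDiffOn, fun t ht => ?_, ?_⟩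
  · rw [iteratedDerivWithin_eq_iteratedDeriv (uniqueDiffOn_Icc hab) hGc.contDiffAt ht, hGd,
      abs_mul, abs_mul, abs_of_pos hA0, abs_of_pos (by positivity : 0 < r⁻¹ ^ m)]
    calc A * (r⁻¹ ^ m * |iteratedDeriv m g (r⁻¹ * (t - c))|)
        ≤ A * (r⁻¹ ^ m * 1) := by gcongr; exact hgd _
      _ = (b - a) * ((m + 1).factorial : ℝ) / 4 := by rw [hA, inv_pow]; field_simp
  · have hsum : ∑ i, w i * G (x i) = 0 :=
      Finset.sum_eq_zero fun j _ => by rw [hGzero _ (hi j), mul_zero]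
    rw [hsum, zero_sub, abs_neg, hint, abs_mul, abs_mul, abs_of_pos hA0, abs_of_pos hr, hgi, hA, hLr,
      Nat.factorial_succ]
    have hn' : (1 : ℝ) ≤ n := by exact_mod_cast hn
    have hpi := Real.pi_gt_three
    have hlhs : (2 * (n + 1) * r) ^ (m + 1 + 1) / (4 ^ (m + 1) * (n + 1 : ℝ) ^ (m + 1 + 1)) =
        r ^ (m + 2) / 2 ^ m := by
      rw [mul_pow, mul_pow, show (4 : ℝ) = 2 * 2 by norm_num, mul_pow]
      field_simp
      ring
    have hrhs : r ^ m * (2 * (n + 1) * r * ((m + 1) * m.factorial : ℝ) / 4) *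
        (r * (Real.pi / (2 ^ (m + 1) * m.factorial))) =
        r ^ (m + 2) / 2 ^ m * ((n + 1) * (m + 1) * Real.pi / 4) := by
      field_simp
      ring
    push_cast
    rw [hlhs, hrhs]
    refine le_mul_of_one_le_right (by positivity) ?_
    have h1 : (2 : ℝ) * 1 ≤ (n + 1) * (m + 1) :=
      mul_le_mul (by linarith) (by linarith [m.cast_nonneg (α := ℝ)]) zero_le_one (by positivity)
    nlinarith
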